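/- There do not exist a measurable function v : [0,1] × ℝ → ℝ, 1-periodic in the space variable (v(t, x+1) = v(t,x)), with (t,x) ↦ v(t,x) integrable on [0,1] × [0,1], and a measurable set E ⊆ [0,1) with 0 < ℒ¹(E) < 1, such that: (i) ∫_0^1 N(v(t,·)) dt < ∞, where for a 1-periodic g ∈ L²([0,1]) we set N(g) = (∑_{n ∈ ℤ} (2πn)² |ĝ_n|²)^{1/2} with ĝ_n = ∫_0^1 g(x) e^{-2πi n x} dx; and (ii) ∫_0^1 v(t,x) dt = 𝟙_E(x) for almost every x ∈ [0,1). -/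

import Mathlib

open MeasureTheory

/-- `n`-th Fourier coefficient of a `1`-periodic function, computed on `[0,1]`. -/
noncomputable def fourierCoeff1 (g : ℝ → ℝ) (n : ℤ) : ℂ :=
  ∫ x in Set.Icc (0 : ℝ) 1,
    (g x : ℂ) * Complex.exp (-(2 * (Real.pi : ℂ) * Complex.I) * (((n : ℝ) * x : ℝ) : ℂ))

/-- The homogeneous `Ḣ¹` seminorm of a `1`-periodic function,
`N(g) = (∑_{n∈ℤ} (2πn)² |ĝ_n|²)^{1/2}`, valued in `[0,∞]`. -/
noncomputable def H1seminorm (g : ℝ → ℝ) : ENNReal :=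
  (∑' n : ℤ, ENNReal.ofReal ((2 * Real.pi * (n : ℝ)) ^ 2 * ‖fourierCoeff1 g n‖ ^ 2)) ^ (1/2 : ℝ)

lemma stmt16_const_of_continuous (G : C(AddCircle (1 : ℝ), ℂ))
    (h : ∀ᵐ x ∂(AddCircle.haarAddCircle : Measure (AddCircle (1 : ℝ))), G x = 0 ∨ G x = 1) :
    (∀ x, G x = 0) ∨ (∀ x, G x = 1) := by
  have hcl : IsClosed {x | G x = 0 ∨ G x = 1} :=
    (isClosed_eq G.continuous continuous_const).union (isClosed_eq G.continuous continuous_const)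
  have hall : ∀ x, G x = 0 ∨ G x = 1 := by
    have h1 : {x | G x = 0 ∨ G x = 1}ᶜ = ∅ :=
      hcl.isOpen_compl.eq_empty_of_measure_zero h
    intro x
    by_contra hx
    have : x ∈ {x | G x = 0 ∨ G x = 1}ᶜ := hx
    rw [h1] at this
    exact this
  have h0 : IsClopen {x | G x = 0} := by
    refine ⟨isClosed_eq G.continuous continuous_const, ?_⟩
    have : {x | G x = 0} = {x | G x = 1}ᶜ := by
      ext x
      rcases hall x with hx | hx <;> simp [hx]
    rw [this]
    exact (isClosed_eq G.continuous continuous_const).isOpen_compl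
  rcases isClopen_iff.1 h0 with h | h
  · right
    intro x
    rcases hall x with hx | hx
    · have : x ∈ {x | G x = 0} := hx
      rw [h] at this
      exact this.elim
    · exact hx
  · left
    intro x
    have : x ∈ {x | G x = 0} := h ▸ Set.mem_univ x
    exact this

lemma stmt16_coeff_lift (f : ℝ → ℝ) (n : ℤ) :
    fourierCoeff (fun x : AddCircle (1 : ℝ) => ((AddCircle.liftIco 1 0 f x : ℝ) : ℂ)) n
      = fourierCoeff1 f n := by
  rw [fourierCoeff_eq_intervalIntegral _ n 0, fourierCoeff1,
    intervalIntegral.integral_of_le (by norm_num), ← integral_Ico_eq_integral_Ioc,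
    integral_Icc_eq_integral_Ico]
  simp only [div_one, one_smul, zero_add]
  refine setIntegral_congr_fun measurableSet_Ico ?_
  intro x hx
  simp only
  rw [AddCircle.liftIco_zero_coe_apply hx, smul_eq_mul, mul_comm, fourier_coe_apply]
  congr 2
  push_cast
  ring

lemma stmt16_not_summable (E : Set ℝ) (hE : MeasurableSet E) (hsub : E ⊆ Set.Ico (0 : ℝ) 1)
    (h0 : 0 < volume E) (h1 : volume E < 1)
    (hs : Summable (fourierCoeff1 (E.indicator (fun _ => (1 : ℝ))))) : False := by
  set f : ℝ → ℝ := E.indicator (fun _ => (1 : ℝ)) with hf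
  set F : AddCircle (1 : ℝ) → ℂ := fun x => ((AddCircle.liftIco 1 0 f x : ℝ) : ℂ) with hF
  have hfm : Measurable f := measurable_const.indicator hE
  have hFm : Measurable F := by
    refine Complex.measurable_ofReal.comp ?_
    exact (hfm.comp measurable_subtype_coe).comp (AddCircle.measurableEquivIco (1 : ℝ) 0).measurable
  have hf01 : ∀ x, f x = 0 ∨ f x = 1 := by
    intro x
    by_cases hx : x ∈ E <;> simp [hf, hx]
  have hF01 : ∀ x, F x = 0 ∨ F x = 1 := by
    intro x
    rcases hf01 (AddCircle.equivIco 1 0 x) with h | h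
    · left; simp [hF, AddCircle.liftIco, h]
    · right; simp [hF, AddCircle.liftIco, h]
  have hLp : MemLp F 2 (AddCircle.haarAddCircle : Measure (AddCircle (1 : ℝ))) := by
    refine MemLp.of_bound hFm.aestronglyMeasurable 1 (Filter.Eventually.of_forall fun x => ?_)
    rcases hF01 x with h | h <;> simp [h]
  have hae := hLp.coeFn_toLp
  have hcoef : ∀ n, fourierCoeff (hLp.toLp F) n = fourierCoeff1 f n := by
    intro n
    rw [fourierCoeff_congr_ae hae, hF, stmt16_coeff_lift]
  have hL2 := hasSum_fourier_series_L2 (hLp.toLp F)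
  simp_rw [hcoef] at hL2
  have hsum : Summable (fun n : ℤ => fourierCoeff1 f n • (fourier n : C(AddCircle (1 : ℝ), ℂ))) := by
    refine .of_norm ?_
    simp_rw [norm_smul, fourier_norm, mul_one]
    exact hs.norm
  obtain ⟨G, hG⟩ := hsum
  have hG2 := (ContinuousMap.toLp (E := ℂ) 2
    (AddCircle.haarAddCircle : Measure (AddCircle (1 : ℝ))) ℂ).hasSum hG
  simp only [map_smul] at hG2
  have hEq := hL2.unique hG2
  have hGF : F =ᵐ[AddCircle.haarAddCircle] G := by
    refine hae.symm.trans ?_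
    rw [hEq]
    exact ContinuousMap.coeFn_toLp _ G
  have hcc := stmt16_const_of_continuous G (by
    filter_upwards [hGF] with x hx
    rw [← hx]; exact hF01 x)
  have hc0 : fourierCoeff (G : AddCircle (1 : ℝ) → ℂ) 0 = ((volume E).toReal : ℂ) := by
    rw [← fourierCoeff_congr_ae hGF, hF, stmt16_coeff_lift, fourierCoeff1]
    simp only [Int.cast_zero, zero_mul, Complex.ofReal_zero, mul_zero, Complex.exp_zero, mul_one]
    rw [integral_complex_ofReal, hf, integral_indicator hE, Measure.restrict_restrict hE,
      Set.inter_eq_left.2 (hsub.trans Set.Ico_subset_Icc_self)]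
    simp [Measure.real]
  rcases hcc with h | h
  · have : fourierCoeff (G : AddCircle (1 : ℝ) → ℂ) 0 = 0 := by
      simp [fourierCoeff, h]
    rw [this] at hc0
    have h3 : (volume E).toReal = 0 := by exact_mod_cast hc0.symm
    rw [ENNReal.toReal_eq_zero_iff] at h3
    rcases h3 with h3 | h3
    · exact h0.ne' h3
    · rw [h3] at h1; exact absurd h1 (by simp)
  · have : fourierCoeff (G : AddCircle (1 : ℝ) → ℂ) 0 = 1 := by
      simp [fourierCoeff, h]
    rw [this] at hc0
    have h3 : (volume E).toReal = 1 := by exact_mod_cast hc0.symm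
    rw [ENNReal.toReal_eq_one_iff] at h3
    exact h1.ne h3

lemma stmt16_summable_of_bound (a : ℤ → ℂ) (C : ℝ)
    (h : ∀ S : Finset ℤ, ∑ n ∈ S, (2 * Real.pi * (n : ℝ)) ^ 2 * ‖a n‖ ^ 2 ≤ C) : Summable a := by
  have h1 : Summable (fun n : ℤ => (2 * Real.pi * (n : ℝ)) ^ 2 * ‖a n‖ ^ 2) :=
    summable_of_sum_le (fun n => by positivity) h
  have h2 : Summable (fun n : ℤ => 1 / (n : ℝ) ^ 2) :=
    Real.summable_one_div_int_pow.2 (by norm_num)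
  have h3 := h1.add h2
  refine .of_norm_bounded_eventually h3 ?_
  have : ({0} : Set ℤ)ᶜ ∈ (Filter.cofinite : Filter ℤ) := (Set.finite_singleton 0).compl_mem_cofinite
  filter_upwards [this] with n hn
  have hn0 : (n : ℝ) ≠ 0 := by exact_mod_cast hn
  have hpi : (1 : ℝ) ≤ 2 * Real.pi := by linarith [Real.pi_gt_three]
  have e1 : (‖a n‖ * |(n : ℝ)|) ^ 2 ≤ (2 * Real.pi * (n : ℝ)) ^ 2 * ‖a n‖ ^ 2 := by
    rw [mul_pow, mul_pow, sq_abs]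
    have : 0 ≤ (n : ℝ) ^ 2 * ‖a n‖ ^ 2 := by positivity
    have hp2 : (1 : ℝ) ≤ (2 * Real.pi) ^ 2 := one_le_pow₀ hpi
    calc ‖a n‖ ^ 2 * (n : ℝ) ^ 2 = 1 * ((n : ℝ) ^ 2 * ‖a n‖ ^ 2) := by ring
      _ ≤ (2 * Real.pi) ^ 2 * ((n : ℝ) ^ 2 * ‖a n‖ ^ 2) := by gcongr
      _ = _ := by ring
  have e2 : 1 / (n : ℝ) ^ 2 = (1 / |(n : ℝ)|) ^ 2 := by rw [div_pow, sq_abs, one_pow]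
  have e3 : ‖a n‖ = (‖a n‖ * |(n : ℝ)|) * (1 / |(n : ℝ)|) := by
    have : |(n : ℝ)| ≠ 0 := abs_ne_zero.2 hn0
    field_simp
  rw [e2]
  nlinarith [sq_nonneg (‖a n‖ * |(n : ℝ)| - 1 / |(n : ℝ)|), sq_nonneg (‖a n‖ * |(n : ℝ)|),
    sq_nonneg (1 / |(n : ℝ)|)]

lemma stmt16_integrable (v : ℝ → ℝ → ℝ)
    (hi : IntegrableOn (Function.uncurry v) (Set.Icc (0 : ℝ) 1 ×ˢ Set.Icc (0 : ℝ) 1)) (n : ℤ) :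
    Integrable (Function.uncurry fun t x : ℝ => (v t x : ℂ) *
      Complex.exp (-(2 * (Real.pi : ℂ) * Complex.I) * (((n : ℝ) * x : ℝ) : ℂ)))
      ((volume.restrict (Set.Icc (0 : ℝ) 1)).prod (volume.restrict (Set.Icc (0 : ℝ) 1))) := by
  rw [IntegrableOn, Measure.volume_eq_prod, ← Measure.prod_restrict] at hi
  have h1 := hi.ofReal (𝕜 := ℂ)
  refine (h1.mul_bdd (c := 1) (g := fun p : ℝ × ℝ =>
    Complex.exp (-(2 * (Real.pi : ℂ) * Complex.I) * (((n : ℝ) * p.2 : ℝ) : ℂ))) ?_ ?_)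
  · exact (by fun_prop : Continuous _).aestronglyMeasurable
  · refine Filter.Eventually.of_forall fun p => ?_
    rw [Complex.norm_exp]
    simp

lemma stmt16_fubini (v : ℝ → ℝ → ℝ)
    (hi : IntegrableOn (Function.uncurry v) (Set.Icc (0 : ℝ) 1 ×ˢ Set.Icc (0 : ℝ) 1))
    (f : ℝ → ℝ)
    (hf : ∀ᵐ x ∂(volume.restrict (Set.Ico (0 : ℝ) 1)), (∫ t in Set.Icc (0 : ℝ) 1, v t x) = f x)
    (n : ℤ) :
    fourierCoeff1 f n = ∫ t in Set.Icc (0 : ℝ) 1, fourierCoeff1 (v t) n := by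
  simp only [fourierCoeff1]
  rw [integral_integral_swap (stmt16_integrable v hi n)]
  rw [Measure.restrict_congr_set Ico_ae_eq_Icc] at hf
  refine integral_congr_ae ?_
  filter_upwards [hf] with x hx
  rw [integral_mul_const, integral_complex_ofReal, hx]

lemma stmt16_minkowski (v : ℝ → ℝ → ℝ)
    (hi : IntegrableOn (Function.uncurry v) (Set.Icc (0 : ℝ) 1 ×ˢ Set.Icc (0 : ℝ) 1))
    (hN : (∫⁻ t in Set.Icc (0 : ℝ) 1, H1seminorm (v t)) < ⊤)
    (a : ℤ → ℂ) (ha : ∀ n, a n = ∫ t in Set.Icc (0 : ℝ) 1, fourierCoeff1 (v t) n)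
    (S : Finset ℤ) :
    ∑ n ∈ S, (2 * Real.pi * (n : ℝ)) ^ 2 * ‖a n‖ ^ 2
      ≤ (∫⁻ t in Set.Icc (0 : ℝ) 1, H1seminorm (v t)).toReal ^ 2 := by
  set Φ : ℝ → EuclideanSpace ℂ S := fun t =>
    WithLp.toLp 2 (fun n : S => ((2 * Real.pi * ((n : ℤ) : ℝ) : ℝ) : ℂ) * fourierCoeff1 (v t) n)
    with hΦ
  have hnorm : ∀ w : ℤ → ℂ, ‖(WithLp.toLp 2
      (fun n : S => ((2 * Real.pi * ((n : ℤ) : ℝ) : ℝ) : ℂ) * w n) : EuclideanSpace ℂ S)‖ ^ 2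
      = ∑ n ∈ S, (2 * Real.pi * (n : ℝ)) ^ 2 * ‖w n‖ ^ 2 := by
    intro w
    rw [EuclideanSpace.norm_sq_eq, ← Finset.sum_coe_sort S]
    refine Finset.sum_congr rfl fun n _ => ?_
    simp only [norm_mul, mul_pow, Complex.norm_real, Real.norm_eq_abs, sq_abs]
  have hint : ∀ n : S, Integrable (fun t => Φ t n) (volume.restrict (Set.Icc (0 : ℝ) 1)) := by
    intro n
    exact ((stmt16_integrable v hi n).integral_prod_left).const_mul _
  have hPhi : ∫ t in Set.Icc (0 : ℝ) 1, Φ t = WithLp.toLp 2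
      (fun n : S => ((2 * Real.pi * ((n : ℤ) : ℝ) : ℝ) : ℂ) * a n) := by
    ext n
    rw [eval_integral_piLp hint]
    simp only [hΦ]
    rw [integral_const_mul, ha]
  rw [← hnorm a, ← hPhi]
  have hle : ‖∫ t in Set.Icc (0 : ℝ) 1, Φ t‖ₑ ≤ ∫⁻ t in Set.Icc (0 : ℝ) 1, H1seminorm (v t) := by
    refine (enorm_integral_le_lintegral_enorm _).trans (lintegral_mono fun t => ?_)
    rw [H1seminorm, one_div, ENNReal.le_rpow_inv_iff (by norm_num)]
    refine le_trans (le_of_eq ?_) (ENNReal.sum_le_tsum S)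
    rw [← ENNReal.ofReal_sum_of_nonneg (fun n _ => by positivity), ← hnorm (fourierCoeff1 (v t)),
      ← ofReal_norm, ENNReal.ofReal_pow (norm_nonneg _)]
    norm_num [hΦ]
  have h2 := ENNReal.toReal_mono hN.ne hle
  rw [toReal_enorm] at h2
  gcongr

/-- No modulated shear flow with velocity in `L¹_t(Ḣ¹_x)` can have total
advection equal to the characteristic function of a set of intermediate measure: there is no
measurable, spatially `1`-periodic `v` which is integrable on `[0,1]²`, satisfies
`∫₀¹ N(v(t,·)) dt < ∞`, and has `∫₀¹ v(t,x) dt = 𝟙_E(x)` a.e. with `0 < ℒ¹(E) < 1`. -/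
theorem stmt16 :
    ¬ ∃ (v : ℝ → ℝ → ℝ) (E : Set ℝ),
      Measurable (Function.uncurry v) ∧
      (∀ (t x : ℝ), v t (x + 1) = v t x) ∧
      IntegrableOn (Function.uncurry v) (Set.Icc (0 : ℝ) 1 ×ˢ Set.Icc (0 : ℝ) 1) ∧
      MeasurableSet E ∧ E ⊆ Set.Ico (0 : ℝ) 1 ∧
      0 < volume E ∧ volume E < 1 ∧
      (∫⁻ t in Set.Icc (0 : ℝ) 1, H1seminorm (v t)) < ⊤ ∧
      (∀ᵐ x ∂(volume.restrict (Set.Ico (0 : ℝ) 1)),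
        (∫ t in Set.Icc (0 : ℝ) 1, v t x) = Set.indicator E (fun _ => (1 : ℝ)) x) := by
  rintro ⟨v, E, -, -, hi, hE, hsub, h0, h1, hN, hae⟩
  refine stmt16_not_summable E hE hsub h0 h1 (stmt16_summable_of_bound _
    ((∫⁻ t in Set.Icc (0 : ℝ) 1, H1seminorm (v t)).toReal ^ 2) ?_)
  exact stmt16_minkowski v hi hN _ (stmt16_fubini v hi _ hae)
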